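/- arXiv:2511.03703 — 3 statements merged into one kernel-verified Lean document; each statement's English description precedes it below -/
import Mathlib

section
/- Let F_q be a finite field and let V1 ⊆ F_q^{m1} and V2 ⊆ F_q^{m2} be nonempty sets. Suppose every function f1 : V1 → F_q agrees on V1 with some polynomial in F_q[x_1,…,x_{m1}] of total degree at most d1, and every function f2 : V2 → F_q agrees on V2 with some polynomial in F_q[y_1,…,y_{m2}] of total degree at most d2. Then every function f : V1 × V2 → F_q agrees on V1 × V2 with some polynomial in F_q[x_1,…,x_{m1},y_1,…,y_{m2}] of total degree at most d1 + d2. -/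
open MvPolynomial

/-- `V` has extension degree at most `d`: every function `f : V → F` agrees on `V`
with some polynomial of total degree at most `d`. -/
def HasExtensionDegreeLE {F : Type} [Field F] {σ : Type} (V : Set (σ → F)) (d : ℕ) : Prop :=
  ∀ f : V → F, ∃ P : MvPolynomial σ F,
    P.totalDegree ≤ d ∧ ∀ x : V, eval (x : σ → F) P = f x

theorem extension_degree_of_product
    {F : Type} [Field F] [Fintype F] {m1 m2 : ℕ}
    (V1 : Set (Fin m1 → F)) (V2 : Set (Fin m2 → F))
    (hV1 : V1.Nonempty) (hV2 : V2.Nonempty) (d1 d2 : ℕ)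
    (h1 : HasExtensionDegreeLE V1 d1) (h2 : HasExtensionDegreeLE V2 d2) :
    HasExtensionDegreeLE
      {x : (Fin m1 ⊕ Fin m2) → F | (x ∘ Sum.inl) ∈ V1 ∧ (x ∘ Sum.inr) ∈ V2}
      (d1 + d2) := by
  classical
  intro f
  choose P hPdeg hP using fun a : V1 => h1 (Pi.single a 1)
  choose Q hQdeg hQ using fun a : V1 => h2 fun b =>
    f ⟨Sum.elim (a : Fin m1 → F) (b : Fin m2 → F), by
      simp only [Set.mem_ofPred_eq, Sum.elim_comp_inl, Sum.elim_comp_inr]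
      exact ⟨a.2, b.2⟩⟩
  refine ⟨∑ a : V1, rename Sum.inl (P a) * rename Sum.inr (Q a), ?_, ?_⟩
  · refine (totalDegree_finsetSum _ _).trans (Finset.sup_le fun a _ => ?_)
    exact (totalDegree_mul _ _).trans (add_le_add
      ((totalDegree_rename_le _ _).trans (hPdeg a))
      ((totalDegree_rename_le _ _).trans (hQdeg a)))
  · rintro ⟨x, hx₁, hx₂⟩
    simp only [map_sum, map_mul, eval_rename]
    rw [Finset.sum_eq_single ⟨x ∘ Sum.inl, hx₁⟩]
    · rw [hP ⟨x ∘ Sum.inl, hx₁⟩ ⟨x ∘ Sum.inl, hx₁⟩, hQ ⟨x ∘ Sum.inl, hx₁⟩ ⟨x ∘ Sum.inr, hx₂⟩,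
        Pi.single_eq_same, one_mul]
      exact congrArg f (Subtype.ext (Sum.elim_comp_inl_inr x))
    · intro a _ ha
      rw [hP a ⟨x ∘ Sum.inl, hx₁⟩, Pi.single_eq_of_ne ha.symm, zero_mul]
    · exact fun h => absurd (Finset.mem_univ _) h
end

section
/- Let F_q be a finite field and let {0,1}^n_{≤1} ⊆ F_q^n denote the set of 0/1 vectors with at most one coordinate equal to 1. Then the set {x_i² − x_i : 1 ≤ i ≤ n} ∪ {x_i·x_j : 1 ≤ i < j ≤ n} is a Gröbner generating set of the vanishing ideal I({0,1}^n_{≤1}) ⊆ F_q[x_1,…,x_n]: every polynomial P vanishing at every point of {0,1}^n_{≤1} can be written P = Σ_i h_i·(x_i²−x_i) + Σ_{i<j} g_{ij}·(x_i x_j) with deg(h_i·(x_i²−x_i)) ≤ deg(P) and deg(g_{ij}·x_i x_j) ≤ deg(P) for all i, j. -/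
open MvPolynomial

/-- The set of 0/1 vectors in `F^n` with at most one coordinate equal to `1`. -/
def hammingBallOne (F : Type) [Field F] [DecidableEq F] (n : ℕ) : Set (Fin n → F) :=
  {x | (∀ i, x i = 0 ∨ x i = 1) ∧ (Finset.univ.filter (fun i => x i = 1)).card ≤ 1}

/-- The polynomials that are combinations of the family `q` in which no summand has total degree
exceeding `d`. -/
def boundedCombinations {R σ ι : Type*} [CommRing R] [Fintype ι]
    (q : ι → MvPolynomial σ R) (d : ℕ) : Submodule R (MvPolynomial σ R) where
  carrier := {P | ∃ h : ι → MvPolynomial σ R,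
    P = ∑ i, h i * q i ∧ ∀ i, (h i * q i).totalDegree ≤ d}
  zero_mem' := ⟨0, by simp, by simp⟩
  add_mem' := by
    rintro _ _ ⟨h, rfl, hd⟩ ⟨k, rfl, kd⟩
    refine ⟨h + k, by simp [add_mul, Finset.sum_add_distrib], fun i => ?_⟩
    rw [Pi.add_apply, add_mul]
    exact (totalDegree_add _ _).trans (max_le (hd i) (kd i))
  smul_mem' := by
    rintro c _ ⟨h, rfl, hd⟩
    refine ⟨c • h, by simp [Finset.smul_sum], fun i => ?_⟩
    rw [Pi.smul_apply, smul_mul_assoc]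
    exact (totalDegree_smul_le _ _).trans (hd i)

section BoundedCombinations

variable {R σ ι : Type*} [CommRing R] [Fintype ι] {q : ι → MvPolynomial σ R} {d e : ℕ}

theorem boundedCombinations_mono (hde : d ≤ e) :
    boundedCombinations q d ≤ boundedCombinations q e := by
  rintro _ ⟨h, rfl, hd⟩
  exact ⟨h, rfl, fun i => (hd i).trans hde⟩

theorem boundedCombinations_sup_mono {A : Submodule R (MvPolynomial σ R)} (hde : d ≤ e) :
    boundedCombinations q d ⊔ A ≤ boundedCombinations q e ⊔ A :=
  sup_le_sup_right (boundedCombinations_mono hde) A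

theorem mem_boundedCombinations_self (i : ι) (hi : (q i).totalDegree ≤ d) :
    q i ∈ boundedCombinations q d := by
  classical
  refine ⟨Pi.single i 1, by simp [Pi.single_apply], fun j => ?_⟩
  by_cases hj : j = i
  · subst hj
    simpa using hi
  · simp [hj]

theorem mul_X_mem_boundedCombinations {P : MvPolynomial σ R}
    (hP : P ∈ boundedCombinations q d) (k : σ) :
    P * X k ∈ boundedCombinations q (d + 1) := by
  obtain ⟨h, rfl, hd⟩ := hP
  refine ⟨fun i => h i * X k, ?_, fun i => ?_⟩
  · rw [Finset.sum_mul]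
    exact Finset.sum_congr rfl fun i _ => by ring
  · rw [mul_right_comm]
    refine (totalDegree_mul _ _).trans (add_le_add (hd i) ?_)
    exact (totalDegree_monomial_le _ _).trans (by simp)

theorem eval_eq_zero_of_mem_boundedCombinations {P : MvPolynomial σ R}
    (hP : P ∈ boundedCombinations q d) {x : σ → R} (hx : ∀ i, eval x (q i) = 0) :
    eval x P = 0 := by
  obtain ⟨h, rfl, -⟩ := hP
  simp [hx]

end BoundedCombinations

/-- The polynomials `X i ^ 2 - X i`, together with the products `X i * X j` for `i < j`. -/
noncomputable def hammingGenerators (F : Type*) [Field F] (n : ℕ) :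
    Fin n ⊕ {p : Fin n × Fin n // p.1 < p.2} → MvPolynomial (Fin n) F :=
  Sum.elim (fun i => X i ^ 2 - X i) (fun p => X p.1.1 * X p.1.2)

/-- The span of the constant polynomial `1` and the variables. -/
noncomputable def affinePolynomials (F : Type*) [Field F] (n : ℕ) : Submodule F (MvPolynomial (Fin n) F) :=
  Submodule.span F (insert 1 (Set.range X))

section HammingGenerators

variable {F : Type*} [Field F] {n : ℕ}

theorem totalDegree_hammingGenerators_le (a : Fin n ⊕ {p : Fin n × Fin n // p.1 < p.2}) :
    (hammingGenerators F n a).totalDegree ≤ 2 := by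
  rcases a with i | p
  · refine (totalDegree_sub _ _).trans (max_le ?_ ?_) <;> simp
  · exact (totalDegree_mul _ _).trans (by simp)

theorem one_mem_affinePolynomials : 1 ∈ affinePolynomials F n :=
  Submodule.subset_span (Set.mem_insert _ _)

theorem X_mem_affinePolynomials (i : Fin n) : X i ∈ affinePolynomials F n :=
  Submodule.subset_span (Set.mem_insert_of_mem _ ⟨i, rfl⟩)

theorem eq_of_mem_affinePolynomials {P : MvPolynomial (Fin n) F}
    (hP : P ∈ affinePolynomials F n) :
    P = C (eval 0 P) + ∑ i, C (eval (Pi.single i 1) P - eval 0 P) * X i := by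
  induction hP using Submodule.span_induction with
  | mem P hP =>
    rcases hP with rfl | ⟨i, rfl⟩
    · simp
    · simp [Pi.single_apply, Finset.sum_ite_eq]
  | zero => simp
  | add P Q _ _ hP hQ =>
    conv_lhs => rw [hP, hQ]
    simp only [map_add, map_sub, add_mul, sub_mul, Finset.sum_add_distrib,
      Finset.sum_sub_distrib]
    ring
  | smul c P _ hP =>
    conv_lhs => rw [hP]
    simp only [smul_eq_C_mul, mul_add, Finset.mul_sum, map_mul, eval_C, ← mul_sub, mul_assoc]

theorem X_mul_X_mem_sup (i j : Fin n) :
    (X i * X j : MvPolynomial (Fin n) F) ∈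
      boundedCombinations (hammingGenerators F n) 2 ⊔ affinePolynomials F n := by
  have hgen (a) : hammingGenerators F n a ∈
      boundedCombinations (hammingGenerators F n) 2 ⊔ affinePolynomials F n :=
    Submodule.mem_sup_left
      (mem_boundedCombinations_self a (totalDegree_hammingGenerators_le a))
  rcases lt_trichotomy i j with hij | rfl | hij
  · exact hgen (Sum.inr ⟨(i, j), hij⟩)
  · have h := add_mem (hgen (Sum.inl i)) (Submodule.mem_sup_right (X_mem_affinePolynomials i))
    simpa [hammingGenerators, sq] using h
  · rw [mul_comm]
    exact hgen (Sum.inr ⟨(j, i), hij⟩)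

theorem mul_X_mem_sup {d : ℕ} (hd : 1 ≤ d) {P : MvPolynomial (Fin n) F}
    (hP : P ∈ boundedCombinations (hammingGenerators F n) d ⊔ affinePolynomials F n)
    (k : Fin n) :
    P * X k ∈ boundedCombinations (hammingGenerators F n) (d + 1) ⊔ affinePolynomials F n := by
  obtain ⟨w, hw, a, ha, rfl⟩ := Submodule.mem_sup.1 hP
  rw [add_mul]
  refine add_mem (Submodule.mem_sup_left (mul_X_mem_boundedCombinations hw k)) ?_
  clear hP
  induction ha using Submodule.span_induction with
  | mem P hP =>
    rcases hP with rfl | ⟨i, rfl⟩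
    · rw [one_mul]
      exact Submodule.mem_sup_right (X_mem_affinePolynomials k)
    · exact boundedCombinations_sup_mono (by omega) (X_mul_X_mem_sup i k)
  | zero => simp
  | add P Q _ _ hP hQ =>
    rw [add_mul]
    exact add_mem hP hQ
  | smul c P _ hP =>
    rw [smul_mul_assoc]
    exact Submodule.smul_mem _ c hP

theorem monomial_one_mem_sup (s : Fin n →₀ ℕ) :
    monomial s (1 : F) ∈
      boundedCombinations (hammingGenerators F n) s.degree ⊔ affinePolynomials F n := by
  induction hd : s.degree generalizing s with
  | zero =>
    rw [Finsupp.degree_eq_zero_iff] at hd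
    subst hd
    exact Submodule.mem_sup_right one_mem_affinePolynomials
  | succ d ih =>
    obtain ⟨k, hk⟩ : ∃ k, s k ≠ 0 := by
      by_contra! h
      have : s = 0 := Finsupp.ext h
      simp [this] at hd
    obtain ⟨t, rfl⟩ : ∃ t, s = t + Finsupp.single k 1 :=
      ⟨s - Finsupp.single k 1, (tsub_add_cancel_of_le (by
        simpa [Finsupp.single_le_iff] using Nat.one_le_iff_ne_zero.2 hk)).symm⟩
    have ht : t.degree = d := by simpa using hd
    rw [monomial_add_single, pow_one]
    rcases Nat.eq_zero_or_pos d with rfl | hpos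
    · rw [Finsupp.degree_eq_zero_iff] at ht
      subst ht
      refine Submodule.mem_sup_right ?_
      simpa using X_mem_affinePolynomials (F := F) k
    · exact mul_X_mem_sup hpos (ih t ht) k

theorem mem_boundedCombinations_sup_affinePolynomials (P : MvPolynomial (Fin n) F) :
    P ∈ boundedCombinations (hammingGenerators F n) P.totalDegree ⊔ affinePolynomials F n := by
  have hsum : ∑ s ∈ P.support, monomial s (P.coeff s) ∈
      boundedCombinations (hammingGenerators F n) P.totalDegree ⊔ affinePolynomials F n := by
    refine Submodule.sum_mem _ fun s hs => ?_
    rw [← mul_one (P.coeff s), ← smul_eq_mul, ← smul_monomial]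
    exact Submodule.smul_mem _ _ 
      (boundedCombinations_sup_mono (le_totalDegree hs) (monomial_one_mem_sup s))
  rwa [← P.as_sum] at hsum

end HammingGenerators

theorem eval_hammingGenerators_eq_zero {F : Type} [Field F] [DecidableEq F] {n : ℕ}
    {x : Fin n → F} (hx : x ∈ hammingBallOne F n)
    (a : Fin n ⊕ {p : Fin n × Fin n // p.1 < p.2}) :
    eval x (hammingGenerators F n a) = 0 := by
  rcases a with i | ⟨⟨i, j⟩, hij⟩
  · rcases hx.1 i with h | h <;> simp [hammingGenerators, h]
  · rcases hx.1 i with hi | hi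
    · simp [hammingGenerators, hi]
    rcases hx.1 j with hj | hj
    · simp [hammingGenerators, hj]
    · exact absurd (Finset.card_le_one.1 hx.2 i (by simpa using hi) j (by simpa using hj)) hij.ne

theorem grobner_generating_set_hamming_ball_one
    {F : Type} [Field F] [Fintype F] [DecidableEq F] {n : ℕ}
    (P : MvPolynomial (Fin n) F)
    (hP : ∀ x ∈ hammingBallOne F n, eval x P = 0) :
    ∃ h : Fin n → MvPolynomial (Fin n) F,
      ∃ g : Fin n → Fin n → MvPolynomial (Fin n) F,
      P = (∑ i, h i * (X i ^ 2 - X i)) +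
          ∑ p ∈ Finset.univ.filter (fun p : Fin n × Fin n => p.1 < p.2),
            g p.1 p.2 * (X p.1 * X p.2) ∧
      (∀ i, (h i * (X i ^ 2 - X i)).totalDegree ≤ P.totalDegree) ∧
      (∀ i j : Fin n, i < j → (g i j * (X i * X j)).totalDegree ≤ P.totalDegree) := by
  have hzero : (0 : Fin n → F) ∈ hammingBallOne F n := by simp [hammingBallOne]
  have hsingle (i : Fin n) : (Pi.single i 1 : Fin n → F) ∈ hammingBallOne F n := by
    refine ⟨fun j => ?_, Finset.card_le_one.2 fun j hj k hk => ?_⟩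
    · by_cases hj : j = i <;> simp [hj]
    · simp only [Finset.mem_filter_univ, Pi.single_apply, ite_eq_left_iff, zero_ne_one,
        imp_false, not_not] at hj hk
      exact hj.trans hk.symm
  obtain ⟨w, hw, a, ha, hwa⟩ :=
    Submodule.mem_sup.1 (mem_boundedCombinations_sup_affinePolynomials P)
  have ha_eval {x : Fin n → F} (hx : x ∈ hammingBallOne F n) : eval x a = 0 := by
    have h := hP x hx
    rwa [← hwa, map_add, eval_eq_zero_of_mem_boundedCombinations hw
      (eval_hammingGenerators_eq_zero hx), zero_add] at h
  have ha_zero : a = 0 := by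
    rw [eq_of_mem_affinePolynomials ha]
    simp only [ha_eval hzero, ha_eval (hsingle _), sub_zero, map_zero, zero_mul,
      Finset.sum_const_zero, add_zero]
  rw [ha_zero, add_zero] at hwa
  obtain ⟨h, hsum, hdeg⟩ := hw
  refine ⟨fun i => h (Sum.inl i), fun i j => if hij : i < j then h (Sum.inr ⟨(i, j), hij⟩) else 0,
    ?_, fun i => hdeg (Sum.inl i), fun i j hij => ?_⟩
  · rw [← hwa, hsum, Fintype.sum_sum_type]
    congr 1
    rw [Finset.sum_subtype (p := fun p : Fin n × Fin n => p.1 < p.2) _ (by simp)]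
    refine Finset.sum_congr rfl fun p _ => ?_
    simp [hammingGenerators, p.2]
  · simpa [hij, hammingGenerators] using hdeg (Sum.inr ⟨(i, j), hij⟩)
end

section
/- Let F_q be a finite field and let V ⊆ F_q^m be a nonempty (finite) set. Then there exists a finite set S of monomials in F_q[x_1,…,x_m] such that: (i) the restrictions to V of the monomials in S form a basis of the F_q-vector space of all functions V → F_q; and (ii) every polynomial P ∈ F_q[x_1,…,x_m] agrees on V with some F_q-linear combination of monomials from S, each of total degree at most deg(P). -/
open MvPolynomial

/-- Greedy extraction by increasing degree, among the indices of degree less than `N`. -/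
theorem exists_linearIndepOn_graded_of_lt {K W ι : Type*} [DivisionRing K] [AddCommGroup W]
    [Module K W] (v : ι → W) (d : ι → ℕ) (N : ℕ) :
    ∃ S : Set ι, S ⊆ {i | d i < N} ∧ LinearIndepOn K v S ∧
      ∀ i, d i < N → v i ∈ Submodule.span K (v '' {s | s ∈ S ∧ d s ≤ d i}) := by
  induction N with
  | zero => exact ⟨∅, by simp, linearIndepOn_empty K v, by simp⟩
  | succ N ih =>
    obtain ⟨S, hSN, hS, hspan⟩ := ih
    obtain ⟨B, hBN, hSB, hB, hBind⟩ := exists_linearIndepOn_extension hS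
      (hSN.trans fun i (hi : d i < N) => show d i < N + 1 by omega)
    refine ⟨B, hBN, hBind, fun i hi => ?_⟩
    rcases Nat.lt_succ_iff_lt_or_eq.mp hi with h | h
    · refine Submodule.span_mono ?_ (hspan i h)
      exact Set.image_mono fun s hs => ⟨hSB hs.1, hs.2⟩
    · refine Submodule.span_mono ?_ (hB (Set.mem_image_of_mem v hi))
      refine Set.image_mono fun s hs => ⟨hs, ?_⟩
      have : d s < N + 1 := hBN hs
      omega

/-- In a finite-dimensional space, a family graded by `d` contains a finite independent subfamily
such that each member is a combination of members of the subfamily of no larger degree. -/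
theorem exists_linearIndepOn_graded {K W ι : Type*} [DivisionRing K] [AddCommGroup W]
    [Module K W] [FiniteDimensional K W] (v : ι → W) (d : ι → ℕ) :
    ∃ S : Finset ι, LinearIndepOn K v (S : Set ι) ∧
      ∀ i, v i ∈ Submodule.span K (v '' {s | s ∈ S ∧ d s ≤ d i}) := by
  have hfin {A : Set ι} (hA : LinearIndepOn K v A) : A.Finite :=
    Set.finite_coe_iff.mp (LinearIndependent.finite hA)
  obtain ⟨T, -, -, hT, hTind⟩ :=
    exists_linearIndepOn_extension (linearIndepOn_empty K v) (Set.empty_subset Set.univ)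
  obtain ⟨N, hN⟩ := ((hfin hTind).image d).bddAbove
  obtain ⟨S, hSN, hS, hspan⟩ := exists_linearIndepOn_graded_of_lt (K := K) v d (N + 1)
  refine ⟨(hfin hS).toFinset, by simpa using hS, fun i => ?_⟩
  simp only [Set.Finite.mem_toFinset]
  by_cases hi : d i < N + 1
  · exact hspan i hi
  · have hTS : v '' T ⊆ Submodule.span K (v '' {s | s ∈ S ∧ d s ≤ d i}) := by
      rintro _ ⟨t, ht, rfl⟩
      have htN : d t ≤ N := hN (Set.mem_image_of_mem d ht)
      refine Submodule.span_mono ?_ (hspan t (by omega))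
      exact Set.image_mono fun s hs => ⟨hs.1, hs.2.trans (by omega)⟩
    exact Submodule.span_le.mpr hTS (hT (Set.mem_image_of_mem v (Set.mem_univ i)))

/-- Every function on a set of points of a finite affine space is given by a polynomial. -/
theorem exists_eval_eq_on {F σ : Type*} [Field F] [Finite F] [Finite σ] (V : Set (σ → F))
    (f : V → F) : ∃ P : MvPolynomial σ F, ∀ x : V, eval (x : σ → F) P = f x := by
  classical
  cases nonempty_fintype F
  have h : (fun x => if hx : x ∈ V then f ⟨x, hx⟩ else 0) ∈
      (restrictDegree σ F (Fintype.card F - 1)).map (evalₗ F σ) := by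
    rw [map_restrict_dom_evalₗ]
    trivial
  obtain ⟨P, -, hP⟩ := h
  exact ⟨P, fun x => by simpa using congrFun hP x⟩

theorem exists_graded_monomial_basis
    {F : Type} [Field F] [Fintype F] {m : ℕ}
    (V : Set (Fin m → F)) (hV : V.Nonempty) :
    ∃ S : Finset (Fin m →₀ ℕ),
      LinearIndependent F
        (fun s : S => fun x : V => eval (x : Fin m → F) (monomial (s : Fin m →₀ ℕ) (1 : F))) ∧
      Submodule.span F
        (Set.range (fun s : S =>
          fun x : V => eval (x : Fin m → F) (monomial (s : Fin m →₀ ℕ) (1 : F)))) = ⊤ ∧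
      ∀ P : MvPolynomial (Fin m) F, ∃ c : (Fin m →₀ ℕ) → F,
        (∀ s ∈ S, c s ≠ 0 → (s.sum fun _ e => e) ≤ P.totalDegree) ∧
        ∀ x ∈ V, eval x P = ∑ s ∈ S, c s * eval x (monomial s (1 : F)) := by
  classical
  let v : (Fin m →₀ ℕ) → V → F := fun s x => eval (x : Fin m → F) (monomial s (1 : F))
  obtain ⟨S, hS, hspan⟩ :=
    exists_linearIndepOn_graded (K := F) v (fun s => s.sum fun _ e => e)
  have hpoly (P : MvPolynomial (Fin m) F) : (fun x : V => eval (x : Fin m → F) P) ∈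
      Submodule.span F (v '' {s | s ∈ S ∧ (s.sum fun _ e => e) ≤ P.totalDegree}) := by
    have hsum : (fun x : V => eval (x : Fin m → F) P) = ∑ s ∈ P.support, coeff s P • v s := by
      ext x
      simp [v, eval_eq']
    rw [hsum]
    refine Submodule.sum_mem _ fun s hs => Submodule.smul_mem _ _ ?_
    refine Submodule.span_mono ?_ (hspan s)
    exact Set.image_mono fun t ht => ⟨ht.1, ht.2.trans (le_totalDegree hs)⟩
  refine ⟨S, hS, ?_, fun P => ?_⟩
  · refine eq_top_iff.mpr fun f _ => ?_
    obtain ⟨P, hP⟩ := exists_eval_eq_on V f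
    rw [← funext hP]
    refine Submodule.span_mono ?_ (hpoly P)
    rintro _ ⟨s, hs, rfl⟩
    exact ⟨⟨s, hs.1⟩, rfl⟩
  · have h := hpoly P
    rw [← Finset.coe_filter, Submodule.mem_span_image_finset_iff_exists_fun'] at h
    obtain ⟨c, hc⟩ := h
    refine ⟨fun s => if (s.sum fun _ e => e) ≤ P.totalDegree then c s else 0,
      fun s _ hs => by by_contra h; simp [h] at hs, fun x hx => ?_⟩
    have := congrFun hc ⟨x, hx⟩
    simp only [Finset.sum_apply, Finset.sum_filter] at this
    rw [← this]
    refine Finset.sum_congr rfl fun s _ => ?_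
    beta_reduce
    split_ifs with h
    · rfl
    · exact (zero_mul _).symm
end
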